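/- Let L be a finite set of n affine lines in ℝ² (one-dimensional affine subspaces). Then the number of connected components of the complement ℝ² \ ⋃_{l ∈ L} l is at most n(n−1)/2 + n + 1 = n²/2 + n/2 + 1 (the Lazy caterer bound). -/

import Mathlib

open Set

section HyperplaneArrangement

variable {ι E : Type*} [AddCommGroup E] [Module ℝ E]

/-- The indices `i` for which `x` lies in the open half-space `{x | b i < φ i x}`. -/
noncomputable def positiveSide [Fintype ι] (φ : ι → E →ₗ[ℝ] ℝ) (b : ι → ℝ) (x : E) : Finset ι :=
  open Classical in {i | b i < φ i x}

theorem mem_positiveSide [Fintype ι] {φ : ι → E →ₗ[ℝ] ℝ} {b : ι → ℝ} {x : E} {i : ι} :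
    i ∈ positiveSide φ b x ↔ b i < φ i x := by
  simp [positiveSide]

/-- The sign patterns realised by the points lying on none of the hyperplanes `φ i x = b i`. -/
noncomputable def signPatterns [Fintype ι] (φ : ι → E →ₗ[ℝ] ℝ) (b : ι → ℝ) :
    Finset (Finset ι) :=
  open Classical in {t | ∃ x, (∀ i, φ i x ≠ b i) ∧ positiveSide φ b x = t}

theorem mem_signPatterns [Fintype ι] {φ : ι → E →ₗ[ℝ] ℝ} {b : ι → ℝ} {t : Finset ι} :
    t ∈ signPatterns φ b ↔ ∃ x, (∀ i, φ i x ≠ b i) ∧ positiveSide φ b x = t := by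
  simp [signPatterns]

/-- A set of hyperplanes shattered by the sign patterns has at most `dim E` elements: a linear
relation between the normals takes opposite signs at two suitable points, yet is constant. -/
theorem card_le_finrank_of_shatters_signPatterns [Fintype ι] [DecidableEq ι]
    [FiniteDimensional ℝ E] {φ : ι → E →ₗ[ℝ] ℝ} {b : ι → ℝ} {s : Finset ι}
    (hs : (signPatterns φ b).Shatters s) : s.card ≤ Module.finrank ℝ E := by
  by_contra! hlt
  have hdep : ¬ LinearIndependent ℝ (fun i : s => φ i) := fun h => by
    have h1 := h.fintype_card_le_finrank
    have h2 : Module.finrank ℝ (E →ₗ[ℝ] ℝ) = Module.finrank ℝ E := Subspace.dual_finrank_eq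
    rw [h2, Fintype.card_coe] at h1
    omega
  obtain ⟨g, hg, i₀, hi₀⟩ := Fintype.not_linearIndependent_iff.1 hdep
  have hsum (x : E) : ∑ i, g i * (φ i x - b i) = -∑ i, g i * b i := by
    have := LinearMap.congr_fun hg x
    simp only [LinearMap.coe_sum, Finset.sum_apply, LinearMap.smul_apply, smul_eq_mul,
      LinearMap.zero_apply] at this
    simp only [mul_sub, Finset.sum_sub_distrib, this, zero_sub]
  have key (P : s → Prop) : ∃ x, ∀ i : s, φ i x ≠ b i ∧ (b i < φ i x ↔ P i) := by
    classical
    obtain ⟨u, hu, hsu⟩ := hs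
      (show s.filter (fun i => ∃ h : i ∈ s, P ⟨i, h⟩) ⊆ s from Finset.filter_subset _ _)
    obtain ⟨x, hx, rfl⟩ := mem_signPatterns.1 hu
    refine ⟨x, fun i => ⟨hx i, ?_⟩⟩
    have := Finset.ext_iff.1 hsu i
    simpa [mem_positiveSide] using this
  obtain ⟨x, hx⟩ := key fun i => 0 < g i
  obtain ⟨y, hy⟩ := key fun i => g i < 0
  have hpos : 0 < ∑ i, g i * (φ i x - b i) := by
    have hterm (i : s) (h : g i ≠ 0) : 0 < g i * (φ i x - b i) := by
      obtain ⟨h1, h2⟩ := hx i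
      rcases h.lt_or_gt with h | h
      · have : φ i x < b i := lt_of_le_of_ne (not_lt.1 fun h' => (h2.1 h').not_gt h) h1
        exact mul_pos_of_neg_of_neg h (sub_neg.2 this)
      · exact mul_pos h (sub_pos.2 (h2.2 h))
    refine Finset.sum_pos' (fun i _ => ?_) ⟨i₀, Finset.mem_univ _, hterm i₀ hi₀⟩
    by_cases h : g i = 0
    · simp [h]
    · exact (hterm i h).le
  have hneg : ∑ i, g i * (φ i y - b i) ≤ 0 := by
    refine Finset.sum_nonpos fun i _ => ?_
    obtain ⟨h1, h2⟩ := hy i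
    rcases lt_or_ge (g i) 0 with h | h
    · exact mul_nonpos_of_nonpos_of_nonneg h.le (sub_pos.2 (h2.2 h)).le
    · exact mul_nonpos_of_nonneg_of_nonpos h
        (sub_nonpos.2 (not_lt.1 fun h' => (h2.1 h').not_ge h))
  rw [hsum] at hpos hneg
  exact hpos.not_ge hneg

theorem card_signPatterns_le [Fintype ι] [FiniteDimensional ℝ E] (φ : ι → E →ₗ[ℝ] ℝ)
    (b : ι → ℝ) :
    (signPatterns φ b).card ≤
      ∑ k ∈ Finset.Iic (Module.finrank ℝ E), (Fintype.card ι).choose k := by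
  classical
  refine (Finset.card_le_card_shatterer _).trans (Finset.card_shatterer_le_sum_vcDim.trans ?_)
  refine Finset.sum_le_sum_of_subset (Finset.Iic_subset_Iic.2 ?_)
  exact Finset.sup_le fun s hs =>
    card_le_finrank_of_shatters_signPatterns (Finset.mem_shatterer.1 hs)

theorem convex_setOf_positiveSide_eq [Fintype ι] (φ : ι → E →ₗ[ℝ] ℝ) (b : ι → ℝ)
    (t : Finset ι) : Convex ℝ {x | (∀ i, φ i x ≠ b i) ∧ positiveSide φ b x = t} := by
  have : {x | (∀ i, φ i x ≠ b i) ∧ positiveSide φ b x = t} =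
      ⋂ i, {x | (i ∈ t → b i < φ i x) ∧ (i ∉ t → φ i x < b i)} := by
    ext x
    simp only [mem_ofPred_eq, mem_iInter, Finset.ext_iff, mem_positiveSide, ← forall_and]
    refine forall_congr' fun i => ?_
    rcases lt_trichotomy (φ i x) (b i) with h | h | h
    · simp [h, h.ne, h.not_gt]
    · simp [h]
    · simp [h, h.ne', h.not_gt]
  rw [this]
  refine convex_iInter fun i => ?_
  by_cases hi : i ∈ t
  · simpa [hi] using convex_halfSpace_gt (φ i).isLinear (b i)
  · simpa [hi] using convex_halfSpace_lt (φ i).isLinear (b i)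

/-- Finitely many hyperplanes in a `d`-dimensional real topological vector space divide it into
at most `∑ k ≤ d, (n.choose k)` regions. -/
theorem card_connectedComponents_compl_hyperplanes_le [Fintype ι] [FiniteDimensional ℝ E]
    [TopologicalSpace E] [IsTopologicalAddGroup E] [ContinuousSMul ℝ E]
    (φ : ι → E →ₗ[ℝ] ℝ) (b : ι → ℝ) {U : Set E} (hU : ∀ x, x ∈ U ↔ ∀ i, φ i x ≠ b i) :
    Nat.card (ConnectedComponents U) ≤
      ∑ k ∈ Finset.Iic (Module.finrank ℝ E), (Fintype.card ι).choose k := by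
  refine le_trans ?_ (card_signPatterns_le φ b)
  have hcomp (x y : U) (h : positiveSide φ b x = positiveSide φ b y) :
      (x : ConnectedComponents U) = y := by
    have hconv := (convex_setOf_positiveSide_eq φ b (positiveSide φ b y)).isPreconnected
    have hsub : {x | (∀ i, φ i x ≠ b i) ∧ positiveSide φ b x = positiveSide φ b y} ⊆ U :=
      fun z hz => (hU z).2 hz.1
    rw [← image_preimage_eq_of_subset (hsub.trans Subtype.range_coe.superset),
      Topology.IsInducing.subtypeVal.isPreconnected_image] at hconv
    rw [ConnectedComponents.coe_eq_coe']
    exact hconv.subset_connectedComponent ⟨(hU y).1 y.2, rfl⟩ ⟨(hU x).1 x.2, h⟩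
  let rep : ConnectedComponents U → U := Function.surjInv ConnectedComponents.surjective_coe
  have hrep (c : ConnectedComponents U) : (rep c : ConnectedComponents U) = c :=
    Function.surjInv_eq _ c
  have hinj : Function.Injective (fun c => (⟨positiveSide φ b (rep c),
      mem_signPatterns.2 ⟨rep c, (hU _).1 (rep c).2, rfl⟩⟩ : signPatterns φ b)) := fun c d h => by
    rw [← hrep c, ← hrep d]
    exact hcomp _ _ (Subtype.ext_iff.1 h)
  simpa using Nat.card_le_card_of_injective _ hinj

end HyperplaneArrangement

/-- An affine hyperplane is a level set of a linear form. -/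
theorem AffineSubspace.exists_linearMap_mem_iff_of_finrank_direction_add_one
    {E : Type*} [AddCommGroup E] [Module ℝ E] [FiniteDimensional ℝ E]
    (A : AffineSubspace ℝ E) (hA : (A : Set E).Nonempty)
    (hdim : Module.finrank ℝ A.direction + 1 = Module.finrank ℝ E) :
    ∃ (φ : E →ₗ[ℝ] ℝ) (b : ℝ), ∀ x, x ∈ A ↔ φ x = b := by
  obtain ⟨p, hp⟩ := hA
  have hlt : A.direction < ⊤ := lt_top_iff_ne_top.2 fun h => by
    rw [h, finrank_top] at hdim
    omega
  obtain ⟨φ, hφ, hle⟩ := Submodule.exists_le_ker_of_lt_top A.direction hlt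
  have hker : A.direction = LinearMap.ker φ := by
    refine Submodule.eq_of_le_of_finrank_eq hle ?_
    have := Module.Dual.finrank_ker_add_one_of_ne_zero hφ
    omega
  refine ⟨φ, φ p, fun x => ?_⟩
  rw [← AffineSubspace.vsub_right_mem_direction_iff_mem hp, hker, LinearMap.mem_ker,
    vsub_eq_sub, map_sub, sub_eq_zero]

/-- The Lazy caterer bound: `n` affine lines in the Euclidean plane divide it into at most
`n(n-1)/2 + n + 1` regions (connected components of the complement of their union). -/
theorem lazy_caterer_bound (L : Finset (AffineSubspace ℝ (EuclideanSpace ℝ (Fin 2))))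
    (hline : ∀ l ∈ L, Module.finrank ℝ l.direction = 1) :
    Nat.card (ConnectedComponents
        ↥((⋃ l ∈ L, (l : Set (EuclideanSpace ℝ (Fin 2))))ᶜ)) ≤
      L.card * (L.card - 1) / 2 + L.card + 1 := by
  have hform (l : L) : ∃ (φ : EuclideanSpace ℝ (Fin 2) →ₗ[ℝ] ℝ) (b : ℝ),
      ∀ x, x ∈ (l : AffineSubspace ℝ (EuclideanSpace ℝ (Fin 2))) ↔ φ x = b := by
    have h1 := hline l l.2
    refine AffineSubspace.exists_linearMap_mem_iff_of_finrank_direction_add_one _ ?_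
      (by simp [h1])
    rw [AffineSubspace.nonempty_iff_ne_bot]
    intro h
    rw [h, AffineSubspace.direction_bot, finrank_bot] at h1
    exact zero_ne_one h1
  choose φ b hφ using hform
  have hU (x : EuclideanSpace ℝ (Fin 2)) :
      x ∈ (⋃ l ∈ L, (l : Set (EuclideanSpace ℝ (Fin 2))))ᶜ ↔ ∀ l, φ l x ≠ b l := by
    simp [← hφ]
  refine (card_connectedComponents_compl_hyperplanes_le φ b hU).trans_eq ?_
  have hIic : Finset.Iic 2 = {0, 1, 2} := rfl
  rw [finrank_euclideanSpace_fin, hIic]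
  simp [Nat.choose_two_right]
  ring
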